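/- Let H∈(1/2,1), γ∈(0,2H−1), η∈[0,1], ζ∈[0, min(H−γ, η)], and a_H = H(2H−1). For 0≤s<t<τ'<τ, a_H ∫_s^t ∫_s^t [(τ'−r)^{−γ}−(τ−r)^{−γ}][(τ'−l)^{−γ}−(τ−l)^{−γ}]|r−l|^{2H−2} dr dl ≤ C (τ−τ')^{2η}(τ'−t)^{−2(η−ζ)} min( (τ'−t)^{−2γ−2ζ}(t−s)^{2H}, (t−s)^{2H−2γ−2ζ} ), with C depending only on H, γ, η, ζ. -/

import Mathlib

open MeasureTheory Real

lemma phi_nonneg (γ x d : ℝ) (hγ : 0 ≤ γ) (hx : 0 < x) (hd : 0 < d) :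
    0 ≤ x ^ (-γ) - (x + d) ^ (-γ) :=
  sub_nonneg.2 (Real.rpow_le_rpow_of_nonpos hx (by linarith) (by linarith))

lemma phi_bound (γ θ x d : ℝ) (hγ1 : γ ≤ 1) (hθ : 0 ≤ θ) (hθ1 : θ ≤ 1)
    (hx : 0 < x) (hd : 0 < d) :
    x ^ (-γ) - (x + d) ^ (-γ) ≤ d ^ θ * x ^ (-γ - θ) := by
  have hu : 0 < d / x := by positivity
  have e1 : x + d = x * (1 + d / x) := by field_simp
  have e2 : d ^ θ * x ^ (-γ - θ) = x ^ (-γ) * (d / x) ^ θ := by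
    rw [Real.rpow_sub hx, Real.div_rpow hd.le hx.le]; ring
  rw [e1, Real.mul_rpow hx.le (by positivity), e2]
  generalize d / x = u at hu
  have h1 : 1 - (1 + u) ^ (-γ) ≤ u ^ θ := by
    have h0 : 0 < (1 + u) ^ (-γ) := by positivity
    rcases le_total u 1 with h | h
    · have a1 : u ^ (1:ℝ) ≤ u ^ θ := Real.rpow_le_rpow_of_exponent_ge hu h hθ1
      have a2 : (1 + u) ^ (-1:ℝ) ≤ (1 + u) ^ (-γ) :=
        Real.rpow_le_rpow_of_exponent_le (by linarith) (by linarith)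
      rw [Real.rpow_one] at a1
      rw [Real.rpow_neg_one] at a2
      have a3 : 1 - u ≤ (1 + u)⁻¹ := by
        rw [← one_div, le_div_iff₀ (by linarith)]; nlinarith
      linarith
    · have := Real.one_le_rpow h hθ
      linarith
  have h2 : 0 < x ^ (-γ) := by positivity
  nlinarith

lemma lint_Ioc (a c : ℝ) (ha : 0 < a) (hc : 0 ≤ c) :
    ∫⁻ x in Set.Ioc 0 c, ENNReal.ofReal (x ^ (a - 1)) = ENNReal.ofReal (c ^ a / a) := by
  rw [← ofReal_integral_eq_lintegral_ofReal]
  · rw [← intervalIntegral.integral_of_le hc, integral_rpow (Or.inl (by linarith))]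
    simp [ha.ne']
  · exact (intervalIntegrable_iff_integrableOn_Ioc_of_le hc).1
      (intervalIntegral.intervalIntegrable_rpow' (by linarith))
  · refine (ae_restrict_iff' measurableSet_Ioc).2 (Filter.Eventually.of_forall fun x hx => ?_)
    exact Real.rpow_nonneg hx.1.le _

lemma lint_Ioi (a c : ℝ) (ha : 0 < a) (hc : 0 < c) :
    ∫⁻ x in Set.Ioi c, ENNReal.ofReal (x ^ (-a - 1)) = ENNReal.ofReal (c ^ (-a) / a) := by
  rw [← ofReal_integral_eq_lintegral_ofReal]
  · rw [integral_Ioi_rpow_of_lt (by linarith) hc]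
    simp only [sub_add_cancel, neg_div_neg_eq]
  · exact integrableOn_Ioi_rpow_of_lt (by linarith) hc
  · refine (ae_restrict_iff' measurableSet_Ioi).2 (Filter.Eventually.of_forall fun x hx => ?_)
    exact Real.rpow_nonneg (hc.trans hx).le _

lemma lint_sub_left (h : ℝ → ENNReal) (S T : Set ℝ) (hS : MeasurableSet S)
    (hT : MeasurableSet T) (τ : ℝ) (hST : ∀ r ∈ S, τ - r ∈ T) :
    ∫⁻ r in S, h (τ - r) ≤ ∫⁻ x in T, h x := by
  rw [← lintegral_indicator hS, ← lintegral_indicator hT]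
  rw [← lintegral_sub_left_eq_self (fun x => T.indicator h x) τ]
  refine lintegral_mono fun r => ?_
  by_cases hr : r ∈ S
  · simp [Set.indicator, hr, hST r hr]
  · simp [Set.indicator, hr]

lemma lint_sub_right (h : ℝ → ENNReal) (S T : Set ℝ) (hS : MeasurableSet S)
    (hT : MeasurableSet T) (τ : ℝ) (hST : ∀ r ∈ S, r - τ ∈ T) :
    ∫⁻ r in S, h (r - τ) ≤ ∫⁻ x in T, h x := by
  rw [← lintegral_indicator hS, ← lintegral_indicator hT]
  rw [← lintegral_sub_right_eq_self (fun x => T.indicator h x) τ]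
  refine lintegral_mono fun r => ?_
  by_cases hr : r ∈ S
  · simp [Set.indicator, hr, hST r hr]
  · simp [Set.indicator, hr]

/-- half of the kernel (above the diagonal). -/
noncomputable def Gk (φ : ℝ → ℝ) (a r l : ℝ) : ENNReal :=
  if r < l then ENNReal.ofReal (φ r * φ l * (l - r) ^ (-a)) else 0

lemma Gk_meas (φ : ℝ → ℝ) (hφ : Measurable φ) (a : ℝ) :
    Measurable (fun p : ℝ × ℝ => Gk φ a p.1 p.2) := by
  unfold Gk
  refine Measurable.ite (measurableSet_lt measurable_fst measurable_snd) ?_ measurable_const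
  fun_prop

lemma fold (φ : ℝ → ℝ) (hφ : Measurable φ) (a s t : ℝ) (hst : s ≤ t) (ha : a ≠ 0)
    (h0 : ∀ r ∈ Set.Ioc s t, 0 ≤ φ r) :
    ENNReal.ofReal (∫ r in s..t, ∫ l in s..t, φ r * φ l * |r - l| ^ (-a)) ≤
      2 * ∫⁻ r in Set.Ioc s t, ∫⁻ l in Set.Ioc s t, Gk φ a r l := by
  have hm := Gk_meas φ hφ a
  have key : ENNReal.ofReal (∫ r in s..t, ∫ l in s..t, φ r * φ l * |r - l| ^ (-a)) ≤
      ∫⁻ r in Set.Ioc s t, ∫⁻ l in Set.Ioc s t, (Gk φ a r l + Gk φ a l r) := by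
    refine (Real.ofReal_le_enorm _).trans ?_
    rw [intervalIntegral.integral_of_le hst]
    refine (enorm_integral_le_lintegral_enorm _).trans ?_
    refine setLIntegral_mono' measurableSet_Ioc fun r hr => ?_
    rw [intervalIntegral.integral_of_le hst]
    refine (enorm_integral_le_lintegral_enorm _).trans ?_
    refine setLIntegral_mono' measurableSet_Ioc fun l hl => ?_
    have hr0 := h0 r hr
    have hl0 := h0 l hl
    rw [Real.enorm_of_nonneg (by positivity)]
    unfold Gk
    rcases lt_trichotomy r l with h | h | h
    · rw [if_pos h, abs_sub_comm, abs_of_pos (sub_pos.2 h)]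
      exact le_self_add
    · subst h
      simp [Real.zero_rpow (neg_ne_zero.2 ha)]
    · rw [if_pos h, abs_of_pos (sub_pos.2 h), mul_comm (φ r)]
      exact le_add_self
  refine key.trans (le_of_eq ?_)
  have e : ∀ r, ∫⁻ l in Set.Ioc s t, (Gk φ a r l + Gk φ a l r) =
      (∫⁻ l in Set.Ioc s t, Gk φ a r l) + ∫⁻ l in Set.Ioc s t, Gk φ a l r := fun r =>
    lintegral_add_left (hm.comp measurable_prodMk_left) _
  simp_rw [e]
  rw [lintegral_add_left hm.lintegral_prod_right', two_mul]
  congr 1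
  rw [lintegral_lintegral_swap]
  exact (hm.comp measurable_swap).aemeasurable

lemma innerB' (φ : ℝ → ℝ) (a s t r D : ℝ) (ha : a < 1) (hr : r ∈ Set.Ioc s t)
    (h0 : ∀ l ∈ Set.Ioc s t, 0 ≤ φ l) (hD : ∀ l ∈ Set.Ioc s t, φ l ≤ D) :
    ∫⁻ l in Set.Ioc s t, Gk φ a r l ≤
      ENNReal.ofReal (D * D * ((t - s) ^ (1 - a) / (1 - a))) := by
  have hD0 : 0 ≤ D := (h0 r hr).trans (hD r hr)
  have h1 : ∫⁻ l in Set.Ioc s t, Gk φ a r l ≤ ∫⁻ l in Set.Ioc r t,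
      ENNReal.ofReal (D * D) * ENNReal.ofReal ((l - r) ^ ((1 - a) - 1)) := by
    rw [← lintegral_indicator measurableSet_Ioc, ← lintegral_indicator measurableSet_Ioc]
    refine lintegral_mono fun l => ?_
    by_cases hl : l ∈ Set.Ioc s t
    · by_cases hl2 : r < l
      · simp only [Set.indicator, hl, Gk, hl2, if_true, Set.mem_Ioc, hl.2, true_and]
        rw [← ENNReal.ofReal_mul (by positivity)]
        apply ENNReal.ofReal_le_ofReal
        have e : (1 - a) - 1 = -a := by ring
        rw [e]
        have := sub_pos.2 hl2
        have h3 := h0 l hl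
        have h4 := h0 r hr
        gcongr
        · exact hD r hr
        · exact hD l hl
      · simp [Set.indicator, Gk, hl2]
    · simp [Set.indicator, hl]
  refine h1.trans ?_
  rw [lintegral_const_mul' _ _ ENNReal.ofReal_ne_top, ENNReal.ofReal_mul (p := D * D) (by positivity)]
  refine mul_le_mul_right ?_ _
  refine (lint_sub_right (fun x => ENNReal.ofReal (x ^ ((1 - a) - 1))) _ (Set.Ioc 0 (t - s))
    measurableSet_Ioc measurableSet_Ioc r ?_).trans ?_
  · intro l hl
    exact ⟨by linarith [hl.1], by linarith [hl.2, hr.1]⟩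
  · rw [lint_Ioc _ _ (by linarith) (by linarith [hr.1, hr.2])]

lemma innerB (φ : ℝ → ℝ) (a β s t τ r D : ℝ) (ha0 : 0 < a) (ha : a < 1) (hβ0 : 0 ≤ β)
    (hβ : β < 1) (hr : r ∈ Set.Ioc s t) (htτ : t < τ) (hD0 : 0 ≤ D)
    (h0 : ∀ l ∈ Set.Ioc s t, 0 ≤ φ l) (hD : ∀ l ∈ Set.Ioc s t, φ l ≤ D * (τ - l) ^ (-β)) :
    ∫⁻ l in Set.Ioc s t, Gk φ a r l ≤
      ENNReal.ofReal (φ r * D * (2 ^ a / (1 - β) + 2 ^ β / (1 - a)) * (τ - r) ^ (1 - a - β)) := by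
  have hφr := h0 r hr
  have hx : 0 < τ - r := by linarith [hr.2]
  have hx2 : 0 < (τ - r) / 2 := by positivity
  have h1 : ∫⁻ l in Set.Ioc s t, Gk φ a r l ≤ ∫⁻ l in Set.Ioc r t,
      (ENNReal.ofReal (φ r * D * ((τ - r) / 2) ^ (-a)) * ENNReal.ofReal ((τ - l) ^ ((1 - β) - 1)) +
      ENNReal.ofReal (φ r * D * ((τ - r) / 2) ^ (-β)) * ENNReal.ofReal ((l - r) ^ ((1 - a) - 1))) := by
    rw [← lintegral_indicator measurableSet_Ioc, ← lintegral_indicator measurableSet_Ioc]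
    refine lintegral_mono fun l => ?_
    by_cases hl : l ∈ Set.Ioc s t
    · by_cases hl2 : r < l
      · simp only [Set.indicator, hl, Gk, hl2, if_true, Set.mem_Ioc, hl.2, true_and]
        have hy : 0 < τ - l := by linarith [hl.2]
        have hz := sub_pos.2 hl2
        rw [← ENNReal.ofReal_mul (by positivity), ← ENNReal.ofReal_mul (by positivity),
          ← ENNReal.ofReal_add (by positivity) (by positivity)]
        apply ENNReal.ofReal_le_ofReal
        have e : (1 - a) - 1 = -a := by ring
        have e' : (1 - β) - 1 = -β := by ring
        rw [e, e']
        have h3 := h0 l hl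
        have h4 : φ r * φ l * (l - r) ^ (-a) ≤ φ r * (D * (τ - l) ^ (-β)) * (l - r) ^ (-a) := by
          gcongr
          exact hD l hl
        refine h4.trans ?_
        rcases le_total ((τ - r) / 2) (l - r) with h | h
        · have := Real.rpow_le_rpow_of_nonpos hx2 h (by linarith : -a ≤ 0)
          have h5 : φ r * D * (τ - l) ^ (-β) * (l - r) ^ (-a) ≤
            φ r * D * (τ - l) ^ (-β) * ((τ - r) / 2) ^ (-a) := by gcongr
          have h6 : 0 ≤ φ r * D * ((τ - r) / 2) ^ (-β) * (l - r) ^ (-a) := by positivity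
          linarith
        · have := Real.rpow_le_rpow_of_nonpos hx2 (by linarith : (τ - r) / 2 ≤ τ - l)
            (by linarith : -β ≤ 0)
          have h5 : φ r * D * (τ - l) ^ (-β) * (l - r) ^ (-a) ≤
            φ r * D * ((τ - r) / 2) ^ (-β) * (l - r) ^ (-a) := by gcongr
          have h6 : 0 ≤ φ r * D * ((τ - r) / 2) ^ (-a) * (τ - l) ^ (-β) := by positivity
          linarith
      · simp [Set.indicator, Gk, hl2]
    · simp [Set.indicator, hl]
  refine h1.trans ?_
  rw [lintegral_add_left (by fun_prop), lintegral_const_mul' _ _ ENNReal.ofReal_ne_top,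
    lintegral_const_mul' _ _ ENNReal.ofReal_ne_top]
  have i1 : ∫⁻ l in Set.Ioc r t, ENNReal.ofReal ((τ - l) ^ ((1 - β) - 1)) ≤
      ENNReal.ofReal ((τ - r) ^ (1 - β) / (1 - β)) := by
    refine (lint_sub_left (fun x => ENNReal.ofReal (x ^ ((1 - β) - 1))) _ (Set.Ioc 0 (τ - r))
      measurableSet_Ioc measurableSet_Ioc τ ?_).trans ?_
    · intro l hl
      exact ⟨by linarith [hl.2], by linarith [hl.1]⟩
    · rw [lint_Ioc _ _ (by linarith) hx.le]
  have i2 : ∫⁻ l in Set.Ioc r t, ENNReal.ofReal ((l - r) ^ ((1 - a) - 1)) ≤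
      ENNReal.ofReal ((τ - r) ^ (1 - a) / (1 - a)) := by
    refine (lint_sub_right (fun x => ENNReal.ofReal (x ^ ((1 - a) - 1))) _ (Set.Ioc 0 (τ - r))
      measurableSet_Ioc measurableSet_Ioc r ?_).trans ?_
    · intro l hl
      exact ⟨by linarith [hl.1], by linarith [hl.2]⟩
    · rw [lint_Ioc _ _ (by linarith) hx.le]
  refine (add_le_add (mul_le_mul_right i1 _) (mul_le_mul_right i2 _)).trans ?_
  have hb : 0 < 1 - β := by linarith
  have ha' : 0 < 1 - a := by linarith
  rw [← ENNReal.ofReal_mul (by positivity), ← ENNReal.ofReal_mul (by positivity),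
          ← ENNReal.ofReal_add (by positivity) (by positivity)]
  apply ENNReal.ofReal_le_ofReal
  apply le_of_eq
  rw [Real.div_rpow hx.le (by norm_num), Real.div_rpow hx.le (by norm_num),
    Real.rpow_neg (by norm_num : (0:ℝ) ≤ 2), Real.rpow_neg (by norm_num : (0:ℝ) ≤ 2)]
  have e1 : (τ - r) ^ (1 - a - β) = (τ - r) ^ (-a) * (τ - r) ^ (1 - β) := by
    rw [← Real.rpow_add hx]; congr 1; ring
  have e2 : (τ - r) ^ (1 - a - β) = (τ - r) ^ (-β) * (τ - r) ^ (1 - a) := by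
    rw [← Real.rpow_add hx]; congr 1; ring
  rw [mul_add, add_mul]
  nth_rewrite 1 [e1]
  rw [e2]
  field_simp

lemma outer (H γ η ζ : ℝ)
    (hH2 : H < 1) (hγ0 : 0 < γ) (hγ1 : γ < 1)
    (hη0 : 0 ≤ η) (hη1 : η ≤ 1) (hζ0 : 0 ≤ ζ) (hζ1 : ζ ≤ H - γ) (hζ2 : ζ ≤ η) (hHγ : γ < H) :
    ∃ K > 0, ∀ s t τ d : ℝ, s < t → t < τ → 0 < d → τ - t < t - s →
      ∫⁻ r in Set.Ioc s t, ENNReal.ofReal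
        (((τ - r) ^ (-γ) - (τ - r + d) ^ (-γ)) * (τ - r) ^ (2 * H - 1 - γ - ζ)) ≤
      ENNReal.ofReal (K * (d ^ η * (τ - t) ^ (-(η - ζ)) * (t - s) ^ (2 * H - 2 * γ - 2 * ζ))) := by
  rcases hζ1.lt_or_eq with hlt | heq
  · -- p > 0
    have hp : 0 < 2 * H - 2 * γ - 2 * ζ := by linarith
    set p := 2 * H - 2 * γ - 2 * ζ with hpdef
    refine ⟨2 ^ p / p, by positivity, fun s t τ d hst htτ hd hAB => ?_⟩
    have hA : 0 < τ - t := by linarith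
    have hB : 0 < t - s := by linarith
    have h1 : ∫⁻ r in Set.Ioc s t, ENNReal.ofReal
        (((τ - r) ^ (-γ) - (τ - r + d) ^ (-γ)) * (τ - r) ^ (2 * H - 1 - γ - ζ)) ≤
        ∫⁻ r in Set.Ioc s t, ENNReal.ofReal (d ^ η * (τ - t) ^ (-(η - ζ))) *
          ENNReal.ofReal ((τ - r) ^ (p - 1)) := by
      refine setLIntegral_mono' measurableSet_Ioc fun r hr => ?_
      rw [← ENNReal.ofReal_mul (by positivity)]
      apply ENNReal.ofReal_le_ofReal
      have hx : 0 < τ - r := by linarith [hr.2]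
      have b1 := phi_bound γ η (τ - r) d hγ1.le hη0 hη1 hx hd
      have b2 : (τ - r) ^ (-(η - ζ)) ≤ (τ - t) ^ (-(η - ζ)) :=
        Real.rpow_le_rpow_of_nonpos hA (by linarith [hr.2]) (by linarith)
      calc _ ≤ d ^ η * (τ - r) ^ (-γ - η) * (τ - r) ^ (2 * H - 1 - γ - ζ) := by gcongr
        _ = d ^ η * (τ - r) ^ (-(η - ζ)) * (τ - r) ^ (p - 1) := by
          rw [mul_assoc, mul_assoc, ← Real.rpow_add hx, ← Real.rpow_add hx]
          congr 2; rw [hpdef]; ring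
        _ ≤ _ := by gcongr
    refine h1.trans ?_
    rw [lintegral_const_mul' _ _ ENNReal.ofReal_ne_top]
    have i1 : ∫⁻ r in Set.Ioc s t, ENNReal.ofReal ((τ - r) ^ (p - 1)) ≤
        ENNReal.ofReal ((2 * (t - s)) ^ p / p) := by
      refine (lint_sub_left (fun x => ENNReal.ofReal (x ^ (p - 1))) _ (Set.Ioc 0 (2 * (t - s)))
        measurableSet_Ioc measurableSet_Ioc τ ?_).trans ?_
      · intro l hl
        exact ⟨by linarith [hl.2], by linarith [hl.1]⟩
      · rw [lint_Ioc _ _ hp (by linarith)]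
    refine (mul_le_mul_right i1 _).trans ?_
    rw [← ENNReal.ofReal_mul (by positivity)]
    apply ENNReal.ofReal_le_ofReal
    rw [Real.mul_rpow (by norm_num) hB.le]
    apply le_of_eq; ring
  · have hp : 2 * H - 2 * γ - 2 * ζ = 0 := by linarith
    have hζpos : 0 < ζ := by linarith
    have hζl : 0 < 1 - ζ := by linarith
    have hq : 2 * H - 1 - γ - ζ = H - 1 := by linarith
    simp only [hp, hq, Real.rpow_zero, mul_one]
    rcases hζ2.lt_or_eq with hlt2 | heq2
    · have he : 0 < η - ζ := by linarith
      refine ⟨1 / (η - ζ), by positivity, fun s t τ d hst htτ hd hAB => ?_⟩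
      have hA : 0 < τ - t := by linarith
      have h1 : ∫⁻ r in Set.Ioc s t, ENNReal.ofReal
          (((τ - r) ^ (-γ) - (τ - r + d) ^ (-γ)) * (τ - r) ^ (H - 1)) ≤
          ∫⁻ r in Set.Ioo s t, ENNReal.ofReal (d ^ η) *
            ENNReal.ofReal ((τ - r) ^ (-(η - ζ) - 1)) := by
        rw [← restrict_Ioo_eq_restrict_Ioc]
        refine setLIntegral_mono' measurableSet_Ioo fun r hr => ?_
        rw [← ENNReal.ofReal_mul (by positivity)]
        apply ENNReal.ofReal_le_ofReal
        have hx : 0 < τ - r := by linarith [hr.2]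
        have b1 := phi_bound γ η (τ - r) d hγ1.le hη0 hη1 hx hd
        calc _ ≤ d ^ η * (τ - r) ^ (-γ - η) * (τ - r) ^ (H - 1) := by gcongr
          _ = _ := by
            rw [mul_assoc, ← Real.rpow_add hx]
            congr 2; linarith
      refine h1.trans ?_
      rw [lintegral_const_mul' _ _ ENNReal.ofReal_ne_top]
      have i1 : ∫⁻ r in Set.Ioo s t, ENNReal.ofReal ((τ - r) ^ (-(η - ζ) - 1)) ≤
          ENNReal.ofReal ((τ - t) ^ (-(η - ζ)) / (η - ζ)) := by
        refine (lint_sub_left (fun x => ENNReal.ofReal (x ^ (-(η - ζ) - 1))) _ (Set.Ioi (τ - t))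
          measurableSet_Ioo measurableSet_Ioi τ ?_).trans ?_
        · intro l hl
          simp only [Set.mem_Ioi]
          linarith [hl.2]
        · rw [lint_Ioi _ _ he hA]
      refine (mul_le_mul_right i1 _).trans ?_
      rw [← ENNReal.ofReal_mul (by positivity)]
      apply ENNReal.ofReal_le_ofReal
      apply le_of_eq; ring
    · refine ⟨1 / ζ + 1 / (1 - ζ), by positivity, fun s t τ d hst htτ hd hAB => ?_⟩
      rw [← heq2]
      simp only [sub_self, neg_zero, Real.rpow_zero, mul_one]
      set h : ℝ → ENNReal := fun x => ENNReal.ofReal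
          ((x ^ (-γ) - (x + d) ^ (-γ)) * x ^ (H - 1)) with hh
      refine (lint_sub_left h _ (Set.Ioc 0 d ∪ Set.Ioi d)
        measurableSet_Ioc (measurableSet_Ioc.union measurableSet_Ioi) τ ?_).trans ?_
      · intro l hl
        rw [Set.Ioc_union_Ioi_eq_Ioi hd.le]
        simp only [Set.mem_Ioi]
        linarith [hl.2]
      refine (lintegral_union_le _ _ _).trans ?_
      have i1 : ∫⁻ x in Set.Ioc 0 d, h x ≤ ENNReal.ofReal (d ^ ζ / ζ) := by
        rw [← lint_Ioc _ _ hζpos hd.le]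
        refine setLIntegral_mono' measurableSet_Ioc fun x hx => ?_
        apply ENNReal.ofReal_le_ofReal
        have hx0 : 0 < x := hx.1
        have b1 := phi_bound γ 0 x d hγ1.le le_rfl zero_le_one hx0 hd
        calc _ ≤ d ^ (0:ℝ) * x ^ (-γ - 0) * x ^ (H - 1) := by gcongr
          _ = _ := by
            rw [mul_assoc, ← Real.rpow_add hx0, Real.rpow_zero, one_mul]
            congr 1; linarith
      have i2 : ∫⁻ x in Set.Ioi d, h x ≤ ENNReal.ofReal (d * (d ^ (-(1 - ζ)) / (1 - ζ))) := by
        rw [ENNReal.ofReal_mul hd.le, ← lint_Ioi _ _ hζl hd,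
          ← lintegral_const_mul' _ _ ENNReal.ofReal_ne_top]
        refine setLIntegral_mono' measurableSet_Ioi fun x hx => ?_
        rw [← ENNReal.ofReal_mul hd.le]
        apply ENNReal.ofReal_le_ofReal
        have hx0 : 0 < x := hd.trans hx
        have b1 := phi_bound γ 1 x d hγ1.le zero_le_one le_rfl hx0 hd
        calc _ ≤ d ^ (1:ℝ) * x ^ (-γ - 1) * x ^ (H - 1) := by gcongr
          _ = _ := by
            rw [mul_assoc, ← Real.rpow_add hx0, Real.rpow_one]
            congr 2; linarith
      refine (add_le_add i1 i2).trans ?_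
      rw [← ENNReal.ofReal_add (by positivity) (by positivity)]
      apply ENNReal.ofReal_le_ofReal
      apply le_of_eq
      have e : d * d ^ (-(1 - ζ)) = d ^ ζ := by
        nth_rewrite 1 [← Real.rpow_one d]
        rw [← Real.rpow_add hd]; congr 1; ring
      rw [← mul_div_assoc, e]; ring

theorem stmt_10 (H γ η ζ : ℝ)
    (hH1 : 1/2 < H) (hH2 : H < 1) (hγ0 : 0 < γ) (hγH : γ < 2*H - 1)
    (hη0 : 0 ≤ η) (hη1 : η ≤ 1) (hζ0 : 0 ≤ ζ) (hζ : ζ ≤ min (H - γ) η) :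
    ∃ C > 0, ∀ s t τ' τ : ℝ, 0 ≤ s → s < t → t < τ' → τ' < τ →
      H * (2*H - 1) *
        (∫ r in s..t, ∫ l in s..t,
          ((τ' - r) ^ (-γ) - (τ - r) ^ (-γ)) * ((τ' - l) ^ (-γ) - (τ - l) ^ (-γ)) *
            |r - l| ^ (2*H - 2))
      ≤ C * (τ - τ') ^ (2*η) * (τ' - t) ^ (-(2*(η - ζ))) *
          min ((τ' - t) ^ (-(2*γ) - 2*ζ) * (t - s) ^ (2*H)) ((t - s) ^ (2*H - 2*γ - 2*ζ)) := by
  have hζ1 : ζ ≤ H - γ := hζ.trans (min_le_left _ _)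
  have hζ2 : ζ ≤ η := hζ.trans (min_le_right _ _)
  obtain ⟨K, hK, hout⟩ := outer H γ η ζ hH2 hγ0 (by linarith) hη0 hη1 hζ0 hζ1 hζ2 (by linarith)
  have hβ : 0 < 1 - (γ + ζ) := by linarith
  have ha' : 0 < 1 - (2 - 2 * H) := by linarith
  have hH : 0 < H * (2 * H - 1) := mul_pos (by linarith) (by linarith)
  set a := 2 - 2 * H with hadef
  set K1 := (2:ℝ) ^ a / (1 - (γ + ζ)) + 2 ^ (γ + ζ) / (1 - a) with hK1
  have hK1p : 0 < K1 := by positivity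
  refine ⟨H * (2 * H - 1) * (2 * (K1 * K) + 2 / (1 - a)), by positivity,
    fun s t τ' τ hs hst htτ hττ => ?_⟩
  have hA : 0 < τ' - t := by linarith
  have hB : 0 < t - s := by linarith
  have hd : 0 < τ - τ' := by linarith
  set φ : ℝ → ℝ := fun r => (τ' - r) ^ (-γ) - (τ - r) ^ (-γ) with hφdef
  have hφe : ∀ r, φ r = (τ' - r) ^ (-γ) - (τ' - r + (τ - τ')) ^ (-γ) := by
    intro r; simp only [hφdef]; congr 2; ring
  have hφm : Measurable φ := by simp only [hφdef]; fun_prop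
  have hφ0 : ∀ r ∈ Set.Ioc s t, 0 ≤ φ r := fun r hr => by
    rw [hφe]; exact phi_nonneg γ _ _ hγ0.le (by linarith [hr.2]) hd
  have hφb : ∀ r ∈ Set.Ioc s t, φ r ≤ (τ - τ') ^ η * (τ' - r) ^ (-γ - η) := fun r hr => by
    rw [hφe]; exact phi_bound γ η _ _ (by linarith) hη0 hη1 (by linarith [hr.2]) hd
  have hfold := fold φ hφm a s t hst.le (by linarith) hφ0
  have ea : 2 * H - 2 = -a := by rw [hadef]; ring
  rw [ea]
  set F := ∫ r in s..t, ∫ l in s..t, φ r * φ l * |r - l| ^ (-a) with hF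
  set R := (τ - τ') ^ (2*η) * (τ' - t) ^ (-(2*(η - ζ))) *
          min ((τ' - t) ^ (-(2*γ) - 2*ζ) * (t - s) ^ (2*H)) ((t - s) ^ (2*H - 2*γ - 2*ζ)) with hR
  have hR0 : 0 < R := by positivity
  have sq2 : ∀ x : ℝ, 0 < x → ∀ e : ℝ, x ^ e * x ^ e = x ^ (2 * e) := fun x hx e => by
    rw [← Real.rpow_add hx]; congr 1; ring
  have main : F ≤ (2 * (K1 * K) + 2 / (1 - a)) * R := by
    rcases lt_or_ge (τ' - t) (t - s) with hAB | hAB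
    · have hmin : (t - s) ^ (2*H - 2*γ - 2*ζ) ≤ (τ' - t) ^ (-(2*γ) - 2*ζ) * (t - s) ^ (2*H) := by
        have : (t - s) ^ (2*H - 2*γ - 2*ζ) = (t - s) ^ (-(2*γ) - 2*ζ) * (t - s) ^ (2*H) := by
          rw [← Real.rpow_add hB]; congr 1; ring
        rw [this]
        gcongr ?_ * _
        exact Real.rpow_le_rpow_of_nonpos hA hAB.le (by linarith)
      set D := (τ - τ') ^ η * (τ' - t) ^ (-(η - ζ)) with hD
      have hDp : 0 < D := by positivity
      have hφD : ∀ r ∈ Set.Ioc s t, φ r ≤ D * (τ' - r) ^ (-(γ + ζ)) := fun r hr => by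
        refine (hφb r hr).trans ?_
        have hx : 0 < τ' - r := by linarith [hr.2]
        have b2 : (τ' - r) ^ (-(η - ζ)) ≤ (τ' - t) ^ (-(η - ζ)) :=
          Real.rpow_le_rpow_of_nonpos hA (by linarith [hr.2]) (by linarith)
        have e : (τ' - r) ^ (-γ - η) = (τ' - r) ^ (-(η - ζ)) * (τ' - r) ^ (-(γ + ζ)) := by
          rw [← Real.rpow_add hx]; congr 1; ring
        rw [e, ← mul_assoc, hD]
        gcongr
      have hT : ∫⁻ r in Set.Ioc s t, ∫⁻ l in Set.Ioc s t, Gk φ a r l ≤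
          ENNReal.ofReal (D * K1 * (K * (D * (t - s) ^ (2 * H - 2 * γ - 2 * ζ)))) := by
        rw [ENNReal.ofReal_mul (by positivity)]
        refine le_trans ?_ (mul_le_mul_right (hout s t τ' (τ - τ') hst htτ hd hAB) _)
        rw [← lintegral_const_mul' _ _ ENNReal.ofReal_ne_top]
        refine setLIntegral_mono' measurableSet_Ioc fun r hr => ?_
        refine (innerB φ a (γ + ζ) s t τ' r D (by linarith) (by linarith) (by linarith)
          (by linarith) hr htτ hDp.le hφ0 hφD).trans ?_
        rw [← ENNReal.ofReal_mul (by positivity)]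
        apply ENNReal.ofReal_le_ofReal
        apply le_of_eq
        rw [← hφe, ← hK1]
        have e : 1 - a - (γ + ζ) = 2 * H - 1 - γ - ζ := by rw [hadef]; ring
        rw [e]; ring
      have h2 := hfold.trans (mul_le_mul_right hT 2)
      rw [show (2 : ENNReal) = ENNReal.ofReal 2 by simp, ← ENNReal.ofReal_mul (by norm_num),
        ENNReal.ofReal_le_ofReal_iff (by positivity)] at h2
      have e3 : 2 * (D * K1 * (K * (D * (t - s) ^ (2 * H - 2 * γ - 2 * ζ)))) =
          2 * (K1 * K) * R := by
        rw [hR, min_eq_right hmin, ← sq2 _ hd, show -(2 * (η - ζ)) = 2 * (-(η - ζ)) by ring,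
          ← sq2 _ hA, hD]
        ring
      have : 0 < 2 / (1 - a) * R := by positivity
      rw [e3] at h2
      linarith
    · have hmin : (τ' - t) ^ (-(2*γ) - 2*ζ) * (t - s) ^ (2*H) ≤ (t - s) ^ (2*H - 2*γ - 2*ζ) := by
        have : (t - s) ^ (2*H - 2*γ - 2*ζ) = (t - s) ^ (-(2*γ) - 2*ζ) * (t - s) ^ (2*H) := by
          rw [← Real.rpow_add hB]; congr 1; ring
        rw [this]
        gcongr ?_ * _
        exact Real.rpow_le_rpow_of_nonpos hB hAB (by linarith)
      set D := (τ - τ') ^ η * (τ' - t) ^ (-γ - η) with hD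
      have hDp : 0 < D := by positivity
      have hφD : ∀ r ∈ Set.Ioc s t, φ r ≤ D := fun r hr => by
        refine (hφb r hr).trans ?_
        have b2 : (τ' - r) ^ (-γ - η) ≤ (τ' - t) ^ (-γ - η) :=
          Real.rpow_le_rpow_of_nonpos hA (by linarith [hr.2]) (by linarith)
        rw [hD]
        gcongr
      have hT : ∫⁻ r in Set.Ioc s t, ∫⁻ l in Set.Ioc s t, Gk φ a r l ≤
          ENNReal.ofReal (D * D * ((t - s) ^ (1 - a) / (1 - a)) * (t - s)) := by
        refine (setLIntegral_mono' measurableSet_Ioc fun r hr =>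
          innerB' φ a s t r D (by linarith) hr hφ0 hφD).trans ?_
        rw [setLIntegral_const, Real.volume_Ioc, ← ENNReal.ofReal_mul (by positivity)]
      have h2 := hfold.trans (mul_le_mul_right hT 2)
      rw [show (2 : ENNReal) = ENNReal.ofReal 2 by simp, ← ENNReal.ofReal_mul (by norm_num),
        ENNReal.ofReal_le_ofReal_iff (by positivity)] at h2
      have e3 : 2 * (D * D * ((t - s) ^ (1 - a) / (1 - a)) * (t - s)) =
          2 / (1 - a) * R := by
        have e4 : (t - s) ^ (2 * H) = (t - s) ^ (1 - a) * (t - s) := by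
          nth_rewrite 3 [← Real.rpow_one (t - s)]
          rw [← Real.rpow_add hB]; congr 1; rw [hadef]; ring
        have e5 : (τ' - t) ^ (-γ - η) * (τ' - t) ^ (-γ - η) =
            (τ' - t) ^ (-(2*(η - ζ))) * (τ' - t) ^ (-(2*γ) - 2*ζ) := by
          rw [← Real.rpow_add hA, ← Real.rpow_add hA]; congr 1; ring
        rw [hR, min_eq_left hmin, ← sq2 _ hd, e4]
        have : D * D = (τ - τ') ^ η * (τ - τ') ^ η *
            ((τ' - t) ^ (-γ - η) * (τ' - t) ^ (-γ - η)) := by rw [hD]; ring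
        rw [this, e5]
        ring
      have : 0 < 2 * (K1 * K) * R := by positivity
      rw [e3] at h2
      linarith
  have := mul_le_mul_of_nonneg_left main hH.le
  refine this.trans (le_of_eq ?_)
  rw [hR]; ring
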